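/- For every f ∈ L²(ℝⁿ) and every k ∈ ℤⁿ, τ^θ(T_k^θ f)(ω) = e^{πi (k·k) cot θ} e^{−2πi (k·ω) csc θ} τ^θ(f)(ω) in ℓ²(ℤⁿ), for almost every ω ∈ I. -/

import Mathlib

noncomputable section

open MeasureTheory Complex
open scoped InnerProductSpace ENNReal

abbrev Rn (n : ℕ) : Type := EuclideanSpace ℝ (Fin n)

variable {n : ℕ}

/-- θ-translation: `T_s^θ f (t) = e^{-2πi (s·(t-s)) cot θ} f (t-s)`. -/
def thetaTrans (θ : ℝ) (s : Rn n) (f : Rn n → ℂ) : Rn n → ℂ :=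
  fun t => Complex.exp (((-2 * Real.pi * ⟪s, t - s⟫_ℝ * Real.cot θ : ℝ) : ℂ) * Complex.I) * f (t - s)

/-- Chirp modulation `C_θ f (t) = e^{πi (t·t) cot θ} f(t)`. -/
def chirp (θ : ℝ) (f : Rn n → ℂ) : Rn n → ℂ :=
  fun t => Complex.exp (((Real.pi * ⟪t, t⟫_ℝ * Real.cot θ : ℝ) : ℂ) * Complex.I) * f t

lemma memℒp_chirp (θ : ℝ) (f : Rn n → ℂ) (hf : MemLp f 2 (volume : Measure (Rn n))) :
    MemLp (chirp θ f) 2 (volume : Measure (Rn n)) := by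
  have hcont : Continuous fun t : Rn n =>
      Complex.exp (((Real.pi * ⟪t, t⟫_ℝ * Real.cot θ : ℝ) : ℂ) * Complex.I) :=
    Complex.continuous_exp.comp
      ((Complex.continuous_ofReal.comp
        ((continuous_const.mul ((continuous_id (X := Rn n)).inner continuous_id)).mul
          continuous_const)).mul continuous_const)
  refine ⟨hcont.aestronglyMeasurable.mul hf.1, ?_⟩
  have heq : eLpNorm (chirp θ f) 2 (volume : Measure (Rn n)) = eLpNorm f 2 volume := by
    refine eLpNorm_congr_norm_ae (Filter.Eventually.of_forall fun t => ?_)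
    show ‖Complex.exp (((Real.pi * ⟪t, t⟫_ℝ * Real.cot θ : ℝ) : ℂ) * Complex.I) * f t‖ = ‖f t‖
    rw [norm_mul, Complex.norm_exp_ofReal_mul_I, one_mul]
  exact heq ▸ hf.2

lemma memℒp_thetaTrans (θ : ℝ) (s : Rn n) (f : Rn n → ℂ)
    (hf : MemLp f 2 (volume : Measure (Rn n))) :
    MemLp (thetaTrans θ s f) 2 (volume : Measure (Rn n)) := by
  have htr : MemLp (fun t : Rn n => f (t - s)) 2 (volume : Measure (Rn n)) :=
    hf.comp_measurePreserving (measurePreserving_sub_right volume s)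
  have hcont : Continuous fun t : Rn n =>
      Complex.exp (((-2 * Real.pi * ⟪s, t - s⟫_ℝ * Real.cot θ : ℝ) : ℂ) * Complex.I) :=
    Complex.continuous_exp.comp
      ((Complex.continuous_ofReal.comp
        ((continuous_const.mul
          (continuous_const.inner ((continuous_id (X := Rn n)).sub continuous_const))).mul
          continuous_const)).mul continuous_const)
  refine ⟨hcont.aestronglyMeasurable.mul htr.1, ?_⟩
  have heq : eLpNorm (thetaTrans θ s f) 2 (volume : Measure (Rn n)) =
      eLpNorm (fun t : Rn n => f (t - s)) 2 volume := by
    refine eLpNorm_congr_norm_ae (Filter.Eventually.of_forall fun t => ?_)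
    show ‖Complex.exp (((-2 * Real.pi * ⟪s, t - s⟫_ℝ * Real.cot θ : ℝ) : ℂ) * Complex.I) *
        f (t - s)‖ = ‖f (t - s)‖
    rw [norm_mul, Complex.norm_exp_ofReal_mul_I, one_mul]
  exact heq ▸ htr.2

/-- Chirp modulation as a map on `L²(ℝⁿ)`. -/
def chirpLp (θ : ℝ) (f : Lp ℂ 2 (volume : Measure (Rn n))) :
    Lp ℂ 2 (volume : Measure (Rn n)) :=
  (memℒp_chirp θ f (Lp.memLp f)).toLp (chirp θ f)

/-- θ-translation as a map on `L²(ℝⁿ)`. -/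
def thetaTransLp (θ : ℝ) (s : Rn n) (f : Lp ℂ 2 (volume : Measure (Rn n))) :
    Lp ℂ 2 (volume : Measure (Rn n)) :=
  (memℒp_thetaTrans θ s f (Lp.memLp f)).toLp (thetaTrans θ s f)

/-- `𝓕` is the Fourier–Plancherel transform. -/
def IsPlancherel
    (𝓕 : Lp ℂ 2 (volume : Measure (Rn n)) ≃ₗᵢ[ℂ] Lp ℂ 2 (volume : Measure (Rn n))) : Prop :=
  ∀ (f : Rn n → ℂ) (hf : MemLp f 2 (volume : Measure (Rn n))),
    Integrable f (volume : Measure (Rn n)) →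
      (𝓕 (hf.toLp f) : Rn n → ℂ) =ᵐ[(volume : Measure (Rn n))]
        fun ξ => ∫ t, f t * Complex.exp (((-2 * Real.pi * ⟪t, ξ⟫_ℝ : ℝ) : ℂ) * Complex.I)

/-- The embedding `ℤⁿ ↪ ℝⁿ`. -/
def zcast {n : ℕ} (k : Fin n → ℤ) : Rn n :=
  (WithLp.equiv 2 (Fin n → ℝ)).symm fun i => (k i : ℝ)

/-- The box `I = [0, |sin θ|]ⁿ`. -/
def Iθ (n : ℕ) (θ : ℝ) : Set (Rn n) := {ω | ∀ i, ω i ∈ Set.Icc (0 : ℝ) |Real.sin θ|}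

/-- The fiber `τ^θ f (ω) = |sin θ|^{-n/2} ((C_θ f)^(ω csc θ + k))_{k ∈ ℤⁿ}`. -/
def fiber (𝓕 : Lp ℂ 2 (volume : Measure (Rn n)) ≃ₗᵢ[ℂ] Lp ℂ 2 (volume : Measure (Rn n)))
    (θ : ℝ) (f : Lp ℂ 2 (volume : Measure (Rn n))) (ω : Rn n) (k : Fin n → ℤ) : ℂ :=
  ((|Real.sin θ| ^ (-(n : ℝ) / 2) : ℝ) : ℂ) *
    (𝓕 (chirpLp θ f) : Rn n → ℂ) ((Real.sin θ)⁻¹ • ω + zcast k)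

section UnimodularMultiplication

variable {α : Type*} [MeasurableSpace α] {μ : Measure α} {p : ℝ≥0∞} {m : α → ℂ}

lemma memLp_unimodular_mul (hm : AEStronglyMeasurable m μ) (hm1 : ∀ x, ‖m x‖ = 1)
    {f : α → ℂ} (hf : MemLp f p μ) : MemLp (fun x => m x * f x) p μ :=
  hf.of_le (hm.mul hf.1) (.of_forall fun x => by simp [hm1])

/-- Multiplication by a function of modulus one, as an additive map on `Lᵖ`. -/
def unimodularMulLp (hm : AEStronglyMeasurable m μ) (hm1 : ∀ x, ‖m x‖ = 1) :
    Lp ℂ p μ →+ Lp ℂ p μ :=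
  AddMonoidHom.mk' (fun f => (memLp_unimodular_mul hm hm1 (Lp.memLp f)).toLp _) fun f g => by
    rw [← MemLp.toLp_add]
    refine MemLp.toLp_congr _ _ ?_
    filter_upwards [Lp.coeFn_add f g] with x hx
    simp only [hx, Pi.add_apply, mul_add]

lemma coeFn_unimodularMulLp (hm : AEStronglyMeasurable m μ) (hm1 : ∀ x, ‖m x‖ = 1)
    (f : Lp ℂ p μ) : unimodularMulLp hm hm1 f =ᵐ[μ] fun x => m x * f x :=
  (memLp_unimodular_mul hm hm1 (Lp.memLp f)).coeFn_toLp

lemma isometry_unimodularMulLp [Fact (1 ≤ p)] (hm : AEStronglyMeasurable m μ)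
    (hm1 : ∀ x, ‖m x‖ = 1) :
    Isometry (unimodularMulLp hm hm1 : Lp ℂ p μ → Lp ℂ p μ) :=
  AddMonoidHomClass.isometry_of_norm _ fun f => by
    rw [Lp.norm_def, Lp.norm_def]
    refine congr_arg ENNReal.toReal (eLpNorm_congr_norm_ae ?_)
    filter_upwards [coeFn_unimodularMulLp hm hm1 f] with x hx
    simp [hx, hm1]

end UnimodularMultiplication

/-- The Fourier integral turns translation into modulation. -/
lemma fourier_integral_translate (f : Rn n → ℂ) (s ξ : Rn n) :
    ∫ t, f (t - s) * Complex.exp (((-2 * Real.pi * ⟪t, ξ⟫_ℝ : ℝ) : ℂ) * Complex.I) =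
      Complex.exp (((-2 * Real.pi * ⟪s, ξ⟫_ℝ : ℝ) : ℂ) * Complex.I) *
        ∫ t, f t * Complex.exp (((-2 * Real.pi * ⟪t, ξ⟫_ℝ : ℝ) : ℂ) * Complex.I) := by
  rw [← integral_const_mul, ← integral_sub_right_eq_self (fun t => _ * (f t * _)) s]
  refine integral_congr_ae (.of_forall fun t => ?_)
  have hexp : Complex.exp (((-2 * Real.pi * ⟪t, ξ⟫_ℝ : ℝ) : ℂ) * Complex.I) =
      Complex.exp (((-2 * Real.pi * ⟪s, ξ⟫_ℝ : ℝ) : ℂ) * Complex.I) *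
        Complex.exp (((-2 * Real.pi * ⟪t - s, ξ⟫_ℝ : ℝ) : ℂ) * Complex.I) := by
    rw [← Complex.exp_add, inner_sub_left]
    congr 1
    push_cast
    ring
  simp only [hexp]
  ring

/-- The Plancherel transform turns translation into modulation. -/
lemma IsPlancherel.translate
    {𝓕 : Lp ℂ 2 (volume : Measure (Rn n)) ≃ₗᵢ[ℂ] Lp ℂ 2 (volume : Measure (Rn n))}
    (h𝓕 : IsPlancherel 𝓕) (s : Rn n) (g : Lp ℂ 2 (volume : Measure (Rn n))) :
    𝓕 (Lp.compMeasurePreserving (fun t => t - s) (measurePreserving_sub_right volume s) g)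
      =ᵐ[volume] fun ξ =>
        Complex.exp (((-2 * Real.pi * ⟪s, ξ⟫_ℝ : ℝ) : ℂ) * Complex.I) * 𝓕 g ξ := by
  have hm : AEStronglyMeasurable (fun ξ : Rn n =>
      Complex.exp (((-2 * Real.pi * ⟪s, ξ⟫_ℝ : ℝ) : ℂ) * Complex.I)) volume := by
    apply Continuous.aestronglyMeasurable
    fun_prop
  have hm1 (ξ : Rn n) :
      ‖Complex.exp (((-2 * Real.pi * ⟪s, ξ⟫_ℝ : ℝ) : ℂ) * Complex.I)‖ = 1 :=
    Complex.norm_exp_ofReal_mul_I _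
  suffices h : 𝓕 (Lp.compMeasurePreserving (fun t => t - s)
      (measurePreserving_sub_right volume s) g) = unimodularMulLp hm hm1 (𝓕 g) by
    rw [h]
    exact coeFn_unimodularMulLp hm hm1 _
  induction g using Lp.induction (by simp : (2 : ℝ≥0∞) ≠ ∞) with
  | indicatorConst c hS hμS =>
    rw [Lp.simpleFunc.coe_indicatorConst, indicatorConstLp, Lp.toLp_compMeasurePreserving]
    have hint := (integrable_indicator_iff hS).2 (integrableOn_const (C := c) hμS.ne)
    refine Lp.ext ?_
    filter_upwards [h𝓕 _ (memLp_indicator_const 2 hS c (Or.inr hμS.ne)) hint,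
      h𝓕 _ ((memLp_indicator_const 2 hS c (Or.inr hμS.ne)).comp_measurePreserving
        (measurePreserving_sub_right volume s)) (hint.comp_sub_right s),
      coeFn_unimodularMulLp hm hm1
        (𝓕 ((memLp_indicator_const 2 hS c (Or.inr hμS.ne)).toLp _))] with ξ h₁ h₂ h₃
    rw [h₂, h₃, h₁]
    exact fourier_integral_translate _ s ξ
  | add hf hg _ ihf ihg => simp only [map_add, ihf, ihg]
  | isClosed =>
    exact isClosed_eq
      (𝓕.continuous.comp (Lp.isometry_compMeasurePreserving _).continuous)
      ((isometry_unimodularMulLp hm hm1).continuous.comp 𝓕.continuous)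

lemma chirp_thetaTrans (θ : ℝ) (s : Rn n) (f : Rn n → ℂ) (t : Rn n) :
    chirp θ (thetaTrans θ s f) t =
      Complex.exp (((Real.pi * ⟪s, s⟫_ℝ * Real.cot θ : ℝ) : ℂ) * Complex.I) *
        chirp θ f (t - s) := by
  simp only [chirp, thetaTrans]
  rw [← mul_assoc, ← mul_assoc, ← Complex.exp_add, ← Complex.exp_add]
  congr 2
  simp only [inner_sub_left, inner_sub_right, real_inner_comm s t]
  push_cast
  ring

lemma chirpLp_thetaTransLp (θ : ℝ) (s : Rn n) (f : Lp ℂ 2 (volume : Measure (Rn n))) :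
    chirpLp θ (thetaTransLp θ s f) =
      Complex.exp (((Real.pi * ⟪s, s⟫_ℝ * Real.cot θ : ℝ) : ℂ) * Complex.I) •
        Lp.compMeasurePreserving (fun t => t - s) (measurePreserving_sub_right volume s)
          (chirpLp θ f) := by
  rw [chirpLp, chirpLp, Lp.toLp_compMeasurePreserving, ← MemLp.toLp_const_smul]
  refine MemLp.toLp_congr _ _ ?_
  filter_upwards [(memℒp_thetaTrans θ s f (Lp.memLp f)).coeFn_toLp] with t ht
  have hchirp : chirp θ (thetaTransLp θ s f) t = chirp θ (thetaTrans θ s f) t := by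
    simp only [chirp, thetaTransLp, ht]
  rw [hchirp, chirp_thetaTrans]
  rfl

lemma inner_zcast (k j : Fin n → ℤ) : ⟪zcast k, zcast j⟫_ℝ = ((∑ i, k i * j i : ℤ) : ℝ) := by
  simp [zcast, PiLp.inner_apply, mul_comm]

/-- Modulation by an integer vector is `ℤⁿ`-periodic. -/
lemma exp_inner_zcast_add (k j : Fin n → ℤ) (ξ : Rn n) :
    Complex.exp (((-2 * Real.pi * ⟪zcast k, ξ + zcast j⟫_ℝ : ℝ) : ℂ) * Complex.I) =
      Complex.exp (((-2 * Real.pi * ⟪zcast k, ξ⟫_ℝ : ℝ) : ℂ) * Complex.I) := by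
  rw [Complex.exp_eq_exp_iff_exists_int]
  refine ⟨-∑ i, k i * j i, ?_⟩
  rw [inner_add_right, inner_zcast]
  push_cast
  ring

lemma ae_forall_smul_add_zcast {P : Rn n → Prop} (hP : ∀ᵐ ξ, P ξ) {r : ℝ} (hr : r ≠ 0) :
    ∀ᵐ ω : Rn n, ∀ j : Fin n → ℤ, P (r • ω + zcast j) :=
  ae_all_iff.2 fun j =>
    ((measurePreserving_add_right volume (zcast j)).quasiMeasurePreserving.comp
      (Measure.quasiMeasurePreserving_smul volume hr)).ae hP

/-- `τ^θ(T_k^θ f)(ω) = e^{πi (k·k) cot θ} e^{-2πi (k·ω) csc θ} τ^θ(f)(ω)`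
in `ℓ²(ℤⁿ)` for a.e. `ω ∈ I`. -/
theorem statement10 (n : ℕ) (hn : 1 ≤ n) (θ : ℝ) (hθ : Real.sin θ ≠ 0)
    (𝓕 : Lp ℂ 2 (volume : Measure (Rn n)) ≃ₗᵢ[ℂ] Lp ℂ 2 (volume : Measure (Rn n)))
    (h𝓕 : IsPlancherel 𝓕) :
    ∀ f : Lp ℂ 2 (volume : Measure (Rn n)), ∀ k : Fin n → ℤ,
      ∀ᵐ ω ∂((volume : Measure (Rn n)).restrict (Iθ n θ)), ∀ j : Fin n → ℤ,
        fiber 𝓕 θ (thetaTransLp θ (zcast k) f) ω j =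
          Complex.exp (((Real.pi * ⟪zcast k, zcast k⟫_ℝ * Real.cot θ : ℝ) : ℂ) * Complex.I) *
          Complex.exp (((-2 * Real.pi * ⟪zcast k, ω⟫_ℝ / Real.sin θ : ℝ) : ℂ) * Complex.I) *
          fiber 𝓕 θ f ω j := by
  intro f k
  refine ae_restrict_of_ae ?_
  have hae : ∀ᵐ ξ : Rn n, 𝓕 (chirpLp θ (thetaTransLp θ (zcast k) f)) ξ =
      Complex.exp (((Real.pi * ⟪zcast k, zcast k⟫_ℝ * Real.cot θ : ℝ) : ℂ) * Complex.I) *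
        (Complex.exp (((-2 * Real.pi * ⟪zcast k, ξ⟫_ℝ : ℝ) : ℂ) * Complex.I) *
          𝓕 (chirpLp θ f) ξ) := by
    rw [chirpLp_thetaTransLp, map_smul]
    filter_upwards [Lp.coeFn_smul
      (Complex.exp (((Real.pi * ⟪zcast k, zcast k⟫_ℝ * Real.cot θ : ℝ) : ℂ) * Complex.I))
      (𝓕 (Lp.compMeasurePreserving (fun t => t - zcast k)
        (measurePreserving_sub_right volume (zcast k)) (chirpLp θ f))),
      h𝓕.translate (zcast k) (chirpLp θ f)] with ξ h₁ h₂
    rw [h₁, Pi.smul_apply, h₂, smul_eq_mul]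
  filter_upwards [ae_forall_smul_add_zcast hae (inv_ne_zero hθ)] with ω hω j
  have hinner : -2 * Real.pi * ⟪zcast k, (Real.sin θ)⁻¹ • ω⟫_ℝ =
      -2 * Real.pi * ⟪zcast k, ω⟫_ℝ / Real.sin θ := by
    rw [real_inner_smul_right]
    ring
  rw [fiber, fiber, hω j, exp_inner_zcast_add, hinner]
  ring
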